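/- Let R₅ = 𝔽₅[X,Y]/(Y² − X⁵ + X³ − X), let F be the fraction field of R₅, and write x, y for the images of X, Y in F. Then the polynomial T⁸ + ((4x + 4)y + 3x⁴ + 3x³ + 3x² + 3x + 3)·T⁴ + (x⁵ + 2x⁴ + 2x³ + 2x² + 2x + 1)y + x⁸ + 2x⁶ + x⁵ + 2x⁴ + x³ + 2x² + 1, regarded as a polynomial in T with coefficients in F, is irreducible over F; in particular, the quotient F[T]/(this polynomial) is a field extension of F of degree 8. -/

import Mathlib

noncomputable section

open Polynomial

instance : Fact (Nat.Prime 5) := ⟨by norm_num⟩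

/-- The polynomial `Y² − (X⁵ − X³ + X)` as an element of `𝔽₅[X][Y]`
(the outer variable is `Y`, the inner variable is `X`). -/
def f5 : Polynomial (Polynomial (ZMod 5)) :=
  X ^ 2 - C (X ^ 5 - X ^ 3 + X)

/-- The ring `R₅ = 𝔽₅[X,Y]/(Y² − X⁵ + X³ − X)`. -/
def R5 : Type := Polynomial (Polynomial (ZMod 5)) ⧸ Ideal.span {f5}

instance : CommRing R5 := Ideal.Quotient.commRing _

/-- The quotient map `𝔽₅[X][Y] → R₅`. -/
def toR5 : Polynomial (Polynomial (ZMod 5)) →+* R5 :=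
  Ideal.Quotient.mk (Ideal.span {f5})

/-- The image `x` of `X` in `R₅`. -/
def x5 : R5 := toR5 (C X)

/-- The image `y` of `Y` in `R₅`. -/
def y5 : R5 := toR5 X

/-- The image of `x` in the fraction field `F` of `R₅`. -/
def xF : FractionRing R5 := algebraMap R5 (FractionRing R5) x5

/-- The image of `y` in the fraction field `F` of `R₅`. -/
def yF : FractionRing R5 := algebraMap R5 (FractionRing R5) y5

/-- The degree 8 polynomial
`T⁸ + ((4x + 4)y + 3x⁴ + 3x³ + 3x² + 3x + 3)·T⁴
  + (x⁵ + 2x⁴ + 2x³ + 2x² + 2x + 1)y + x⁸ + 2x⁶ + x⁵ + 2x⁴ + x³ + 2x² + 1`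
with coefficients in `F = Frac(R₅)` (the variable `X` plays the role of `T`). -/
def q13 : Polynomial (FractionRing R5) :=
  X ^ 8 +
    C ((4 * xF + 4) * yF + 3 * xF ^ 4 + 3 * xF ^ 3 + 3 * xF ^ 2 + 3 * xF + 3) * X ^ 4 +
    C ((xF ^ 5 + 2 * xF ^ 4 + 2 * xF ^ 3 + 2 * xF ^ 2 + 2 * xF + 1) * yF +
      xF ^ 8 + 2 * xF ^ 6 + xF ^ 5 + 2 * xF ^ 4 + xF ^ 3 + 2 * xF ^ 2 + 1)

/-- The polynomial `T⁸ - 2` is an irreducible factor of the cyclotomic polynomial `Φ₃₂` over `𝔽₅`. -/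
theorem irreducible_X_pow_eight_sub_two : Irreducible (X ^ 8 - 2 : (ZMod 5)[X]) := by
  have hmonic : (X ^ 8 - 2 : (ZMod 5)[X]).Monic := by monicity!
  have hdeg : (X ^ 8 - 2 : (ZMod 5)[X]).natDegree = 8 := by compute_degree!
  have hunit : ¬ IsUnit (X ^ 8 - 2 : (ZMod 5)[X]) := fun h ↦ by
    have := natDegree_eq_zero_of_isUnit h
    omega
  obtain ⟨g, hg, hdvd⟩ := WfDvdMonoid.exists_irreducible_factor hunit hmonic.ne_zero
  have hcyc : (X ^ 8 - 2 : (ZMod 5)[X]) ∣ cyclotomic 32 (ZMod 5) := by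
    have h := cyclotomic_prime_pow_eq_geom_sum (R := ZMod 5) (p := 2) (n := 4) Nat.prime_two
    norm_num [Finset.sum_range_succ] at h
    rw [h]
    refine ⟨X ^ 8 + 2, ?_⟩
    have h5 : (5 : (ZMod 5)[X]) = 0 := by
      exact_mod_cast CharP.cast_eq_zero ((ZMod 5)[X]) 5
    linear_combination h5
  have hgdeg := natDegree_of_dvd_cyclotomic_of_irreducible (K := ZMod 5) (p := 5) (f := 1) (n := 32)
    (by simp) (by norm_num) (hdvd.trans hcyc) hg
  have horder : orderOf (ZMod.unitOfCoprime (5 ^ 1) (show Nat.Coprime (5 ^ 1) 32 by norm_num)) =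
      2 ^ (2 + 1) := by
    apply orderOf_eq_prime_pow
    · rw [Units.ext_iff]
      simp only [Units.val_pow_eq_pow_val, ZMod.coe_unitOfCoprime, Units.val_one]
      decide
    · rw [Units.ext_iff]
      simp only [Units.val_pow_eq_pow_val, ZMod.coe_unitOfCoprime, Units.val_one]
      decide
  rw [horder] at hgdeg
  exact (associated_of_dvd_of_natDegree_le hdvd hmonic.ne_zero (by omega)).irreducible hg

/-- The right-hand side of the curve equation, expanded at the point `(2, 1)`, is a square in
`𝔽₅⟦t⟧` with a root of constant term `1`. -/
theorem exists_powerSeries_sqrt : ∃ s : PowerSeries (ZMod 5),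
    s ^ 2 = aeval (PowerSeries.X + 2 : PowerSeries (ZMod 5)) (X ^ 5 - X ^ 3 + X : (ZMod 5)[X]) ∧
      PowerSeries.constantCoeff s = 1 := by
  set g := aeval (PowerSeries.X + 2 : PowerSeries (ZMod 5)) (X ^ 5 - X ^ 3 + X : (ZMod 5)[X])
    with hg
  have hg0 : PowerSeries.constantCoeff g = 1 := by
    simp only [hg, map_add, map_sub, map_pow, aeval_X, PowerSeries.constantCoeff_X, map_ofNat]
    decide
  obtain ⟨s, hs, hs1⟩ := HenselianRing.is_henselian
    (I := (Ideal.span {PowerSeries.X} : Ideal (PowerSeries (ZMod 5)))) (X ^ 2 - C g)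
    (monic_X_pow_sub_C g two_ne_zero) 1
    (by
      rw [Ideal.mem_span_singleton, PowerSeries.X_dvd_iff]
      simp [hg0])
    (by
      apply IsUnit.map
      rw [PowerSeries.isUnit_iff_constantCoeff]
      simp
      decide)
  refine ⟨s, ?_, ?_⟩
  · simpa [IsRoot, sub_eq_zero] using hs
  · rw [Ideal.mem_span_singleton, PowerSeries.X_dvd_iff] at hs1
    simpa [sub_eq_zero] using hs1

theorem aeval_powerSeries_X_add_two_injective :
    Function.Injective
      (aeval (PowerSeries.X + 2 : PowerSeries (ZMod 5)) : (ZMod 5)[X] →ₐ[ZMod 5] _) := by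
  rw [injective_iff_map_eq_zero]
  intro a ha
  have h : aeval (PowerSeries.X + 2 : PowerSeries (ZMod 5)) a =
      ((a.comp (X + C 2) : (ZMod 5)[X]) : PowerSeries (ZMod 5)) := by
    have := aeval_algHom_apply (coeToPowerSeries.algHom (ZMod 5) (R := ZMod 5))
      (X + C 2 : (ZMod 5)[X]) a
    have h2 : (PowerSeries.C 2 : PowerSeries (ZMod 5)) = 2 := _root_.map_ofNat _ 2
    simpa [coeToPowerSeries.algHom_apply, h2, comp, aeval_def] using this
  rwa [h, coe_eq_zero_iff, comp_X_add_C_eq_zero_iff] at ha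

/-- An odd-degree polynomial times a nonzero square is never a square. -/
theorem eq_zero_of_sq_eq_sq_mul {K : Type*} [Field K] {a b f : K[X]} (hf : Odd f.natDegree)
    (h : a ^ 2 = b ^ 2 * f) : a = 0 ∧ b = 0 := by
  have hf0 : f ≠ 0 := by rintro rfl; simp at hf
  by_cases hb : b = 0
  · simpa [hb] using h
  · have := congrArg natDegree h
    rw [natDegree_mul (pow_ne_zero 2 hb) hf0, natDegree_pow, natDegree_pow] at this
    obtain ⟨k, hk⟩ := hf
    omega

/-- Expansion of functions on the curve at the point `(2, 1)`, with parameter `t = x - 2`. -/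
theorem exists_powerSeries_embedding : ∃ φ : R5 →+* PowerSeries (ZMod 5),
    Function.Injective φ ∧ φ x5 = PowerSeries.X + 2 ∧ PowerSeries.constantCoeff (φ y5) = 1 := by
  obtain ⟨s, hs, hs1⟩ := exists_powerSeries_sqrt
  set ev := (aeval (PowerSeries.X + 2 : PowerSeries (ZMod 5)) : (ZMod 5)[X] →ₐ[ZMod 5] _)
  have hf5 : eval₂RingHom (ev : (ZMod 5)[X] →+* _) s f5 = 0 := by
    simp only [f5, coe_eval₂RingHom, eval₂_sub, eval₂_X_pow, eval₂_C, hs]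
    exact sub_self _
  refine ⟨Ideal.Quotient.lift (Ideal.span {f5}) (eval₂RingHom (ev : (ZMod 5)[X] →+* _) s) ?_,
    ?_, ?_, ?_⟩
  · intro p hp
    obtain ⟨r, rfl⟩ := Ideal.mem_span_singleton.mp hp
    rw [map_mul, hf5, zero_mul]
  · apply RingHom.lift_injective_of_ker_le_ideal
    intro p hp
    rw [RingHom.mem_ker] at hp
    have hmonic : f5.Monic := monic_X_pow_sub_C _ two_ne_zero
    have hdeg : f5.natDegree = 2 := natDegree_X_pow_sub_C
    rw [Ideal.mem_span_singleton, ← modByMonic_eq_zero_iff_dvd hmonic]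
    rw [← modByMonic_add_div p f5, map_add, map_mul, hf5, zero_mul, add_zero] at hp
    have hlt : (p %ₘ f5).natDegree ≤ 1 := by
      have := natDegree_modByMonic_lt p hmonic (fun h ↦ by simp [h] at hdeg)
      omega
    obtain ⟨b, a, hab⟩ := exists_eq_X_add_C_of_natDegree_le_one hlt
    rw [hab] at hp ⊢
    simp only [coe_eval₂RingHom, eval₂_add, eval₂_mul, eval₂_C, eval₂_X] at hp
    have hsq : a ^ 2 = b ^ 2 * (X ^ 5 - X ^ 3 + X) := by
      apply aeval_powerSeries_X_add_two_injective
      change ev _ = ev _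
      rw [map_mul, map_pow, map_pow, ← hs]
      change ev b * s + ev a = 0 at hp
      linear_combination (ev a - ev b * s) * hp
    have hodd : Odd (X ^ 5 - X ^ 3 + X : (ZMod 5)[X]).natDegree := by
      rw [show (X ^ 5 - X ^ 3 + X : (ZMod 5)[X]).natDegree = 5 by compute_degree!]
      decide
    obtain ⟨rfl, rfl⟩ := eq_zero_of_sq_eq_sq_mul hodd hsq
    simp
  · change eval₂RingHom (ev : (ZMod 5)[X] →+* _) s (C X) = _
    simp [ev]
  · change PowerSeries.constantCoeff (eval₂RingHom (ev : (ZMod 5)[X] →+* _) s X) = _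
    simpa using hs1

theorem q13_monic : q13.Monic := by
  unfold q13
  monicity!

theorem q13_natDegree [Nontrivial (FractionRing R5)] : q13.natDegree = 8 := by
  unfold q13
  compute_degree!

theorem irreducible_q13 [IsDomain R5] : Irreducible q13 := by
  obtain ⟨φ, hφ, hx, hy⟩ := exists_powerSeries_embedding
  let K := FractionRing (PowerSeries (ZMod 5))
  have hinj : Function.Injective ((algebraMap (PowerSeries (ZMod 5)) K).comp φ) :=
    (IsFractionRing.injective (PowerSeries (ZMod 5)) K).comp hφ
  let ψ : FractionRing R5 →+* K := IsFractionRing.lift hinj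
  have hψ (r : R5) : ψ (algebraMap R5 _ r) = algebraMap (PowerSeries (ZMod 5)) K (φ r) :=
    IsFractionRing.lift_algebraMap hinj r
  let x := φ x5
  let y := φ y5
  let q : (PowerSeries (ZMod 5))[X] := X ^ 8 +
    C ((4 * x + 4) * y + 3 * x ^ 4 + 3 * x ^ 3 + 3 * x ^ 2 + 3 * x + 3) * X ^ 4 +
    C ((x ^ 5 + 2 * x ^ 4 + 2 * x ^ 3 + 2 * x ^ 2 + 2 * x + 1) * y +
      x ^ 8 + 2 * x ^ 6 + x ^ 5 + 2 * x ^ 4 + x ^ 3 + 2 * x ^ 2 + 1)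
  have hq : q.Monic := by
    simp only [q]
    monicity!
  have hmap : q13.map ψ = q.map (algebraMap (PowerSeries (ZMod 5)) K) := by
    simp only [q13, q, Polynomial.map_add, Polynomial.map_mul, Polynomial.map_pow, map_X, map_C,
      map_add, map_mul, map_pow, _root_.map_ofNat,
      _root_.map_one, Polynomial.map_ofNat, Polynomial.map_one, xF, yF, hψ, x, y]
  have hred : q.map PowerSeries.constantCoeff = (X ^ 8 - 2 : (ZMod 5)[X]) := by
    have hx0 : PowerSeries.constantCoeff x = 2 := by simp [x, hx, _root_.map_ofNat]
    have hy0 : PowerSeries.constantCoeff y = 1 := hy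
    simp only [q, Polynomial.map_add, Polynomial.map_mul, Polynomial.map_pow, map_X, map_C,
      map_add, map_mul, map_pow, _root_.map_ofNat, _root_.map_one, Polynomial.map_ofNat,
      Polynomial.map_one, hx0, hy0]
    have h5 : (5 : (ZMod 5)[X]) = 0 := by
      exact_mod_cast CharP.cast_eq_zero ((ZMod 5)[X]) 5
    linear_combination (21 * X ^ 4 + 112) * h5
  have hirr : Irreducible q :=
    hq.irreducible_of_irreducible_map PowerSeries.constantCoeff q
      (hred ▸ irreducible_X_pow_eight_sub_two)
  refine q13_monic.irreducible_of_irreducible_map ψ q13 ?_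
  rw [hmap]
  exact hq.irreducible_iff_irreducible_map_fraction_map.mp hirr

/-- The displayed degree 8 polynomial is irreducible over `F = Frac(R₅)`; in particular
`F[T]/(q13)`, i.e. `AdjoinRoot q13`, is a field and has degree 8 over `F`. -/
theorem stmt_13 :
    Irreducible q13 ∧ IsField (AdjoinRoot q13) ∧
    Module.finrank (FractionRing R5) (AdjoinRoot q13) = 8 := by
  obtain ⟨φ, hφ, -⟩ := exists_powerSeries_embedding
  have : IsDomain R5 := hφ.isDomain φ
  have hirr := irreducible_q13
  have : Fact (Irreducible q13) := ⟨hirr⟩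
  refine ⟨hirr, Field.toIsField (AdjoinRoot q13), ?_⟩
  rw [(AdjoinRoot.powerBasis' q13_monic).finrank, AdjoinRoot.powerBasis'_dim, q13_natDegree]
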